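/- For all n ∈ ℕ with n ≥ 1, every subset I ⊆ {1,…,n}, and every choice of fixed values δ_i ∈ {0,1} for i ∈ {1,…,n} \ I, the face S = { x ∈ {0,1}^n : x_i = δ_i for all i ∉ I } contains exactly one vertex v such that F_n(v) > F_n(w) for every w ∈ S that differs from v in exactly one coordinate; that is, the orientation of the hypercube induced by F_n is a unique sink orientation. -/

import Mathlib

open Finset

/-- `alphaF n x i` is the recursively defined `α_{n,i}(x)`:
`α_{n,n+1}(x) = 0` and `α_{n,i}(x) = x_i + (1 - 2 x_i) α_{n,i+1}(x)` for `i = 1, …, n`. -/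
noncomputable def alphaF (n : ℕ) (x : ℕ → ℝ) (i : ℕ) : ℝ :=
  if h : n + 1 ≤ i then 0 else x i + (1 - 2 * x i) * alphaF n x (i + 1)
termination_by n + 1 - i
decreasing_by omega

/-- `betaF n x i = 2^i (x_i - x_i²)(1 - x_{i-1} + Σ_{j=1}^{i-2} x_j)`, with `x_0 := 1`. -/
noncomputable def betaF (n : ℕ) (x : ℕ → ℝ) (i : ℕ) : ℝ :=
  (2 : ℝ) ^ i * (x i - x i ^ 2) *
    (1 - (if i = 1 then 1 else x (i - 1)) + ∑ j ∈ Finset.Icc 1 (i - 2), x j)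

/-- `Ffun n x = Σ_{i=1}^n (2^{i-1} α_{n,i}(x) - β_{n,i}(x))`. -/
noncomputable def Ffun (n : ℕ) (x : ℕ → ℝ) : ℝ :=
  ∑ i ∈ Finset.Icc 1 n, ((2 : ℝ) ^ (i - 1) * alphaF n x i - betaF n x i)

/-- `partialF n k x` is the partial derivative `∂_k F_n(x)`. -/
noncomputable def partialF (n k : ℕ) (x : ℕ → ℝ) : ℝ :=
  deriv (fun t => Ffun n (Function.update x k t)) (x k)

/-- `partialAlpha n k i x` is the partial derivative `∂_k α_{n,i}(x)`. -/
noncomputable def partialAlpha (n k i : ℕ) (x : ℕ → ℝ) : ℝ :=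
  deriv (fun t => alphaF n (Function.update x k t) i) (x k)

/-- `Pfun n x k = x_{k-1} ∏_{j=1}^{k-2} (1 - x_j)`, with `x_0 := 1`. -/
noncomputable def Pfun (n : ℕ) (x : ℕ → ℝ) (k : ℕ) : ℝ :=
  (if k = 1 then 1 else x (k - 1)) * ∏ j ∈ Finset.Icc 1 (k - 2), (1 - x j)

/-- `Sfun n x k = Σ_{j=k+1}^n x_j`. -/
noncomputable def Sfun (n : ℕ) (x : ℕ → ℝ) (k : ℕ) : ℝ :=
  ∑ j ∈ Finset.Icc (k + 1) n, x j

/-- Two real numbers (which will take integer values) have the same parity. -/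
def SameParity (a b : ℝ) : Prop := ∃ m : ℤ, a - b = 2 * (m : ℝ)

/-- The `k`-th standard unit vector, as a function `ℕ → ℝ` (coordinates `1, …, n`). -/
noncomputable def unitVec (k : ℕ) : ℕ → ℝ := fun i => if i = k then 1 else 0

/-- `inFace n I δ x`: `x` is a vertex of the face of `{0,1}^n` with support `I`,
obtained by fixing all coordinates outside `I` to the values `δ`. -/
def inFace (n : ℕ) (I : Finset ℕ) (δ : ℕ → ℝ) (x : ℕ → ℝ) : Prop :=
  (∀ i ∈ Finset.Icc 1 n, x i = 0 ∨ x i = 1) ∧ ∀ i ∈ Finset.Icc 1 n, i ∉ I → x i = δ i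

theorem alpha_top (n : ℕ) (x : ℕ → ℝ) (i : ℕ) (h : n + 1 ≤ i) : alphaF n x i = 0 := by
  rw [alphaF]; simp [h]

theorem alpha_step (n : ℕ) (x : ℕ → ℝ) (i : ℕ) (h : i ≤ n) :
    alphaF n x i = x i + (1 - 2 * x i) * alphaF n x (i + 1) := by
  rw [alphaF, dif_neg (by omega)]

theorem down_ind (n : ℕ) (P : ℕ → Prop) (h0 : ∀ i, n + 1 ≤ i → P i)
    (hs : ∀ i, 1 ≤ i → i ≤ n → P (i + 1) → P i) (i : ℕ) (hi : 1 ≤ i) : P i := by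
  have key : ∀ d i, 1 ≤ i → n + 1 ≤ i + d → P i := by
    intro d
    induction d with
    | zero => intro i _ h; exact h0 i (by omega)
    | succ d ih =>
      intro i h1 h
      by_cases hin : i ≤ n
      · exact hs i h1 hin (ih (i + 1) (by omega) (by omega))
      · exact h0 i (by omega)
  exact key (n + 1) i hi (by omega)

theorem alpha01 (n : ℕ) (x : ℕ → ℝ) (hx : ∀ i ∈ Finset.Icc 1 n, x i = 0 ∨ x i = 1)
    (i : ℕ) (hi : 1 ≤ i) : alphaF n x i = 0 ∨ alphaF n x i = 1 := by
  refine down_ind n (fun i => alphaF n x i = 0 ∨ alphaF n x i = 1) ?_ ?_ i hi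
  · intro i h; left; exact alpha_top n x i h
  · intro i h1 h2 ih
    rw [alpha_step n x i h2]
    rcases hx i (Finset.mem_Icc.2 ⟨h1, h2⟩) with h | h <;> rcases ih with h' | h' <;>
      rw [h, h'] <;> norm_num

theorem alpha_flip (n : ℕ) (x y : ℕ → ℝ) (hx : ∀ i ∈ Finset.Icc 1 n, x i = 0 ∨ x i = 1)
    (hy : ∀ i ∈ Finset.Icc 1 n, y i = 0 ∨ y i = 1) (k : ℕ) (hk : k ∈ Finset.Icc 1 n)
    (hne : y k ≠ x k) (he : ∀ j ∈ Finset.Icc 1 n, j ≠ k → y j = x j) (i : ℕ) (hi : 1 ≤ i) :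
    (k < i → alphaF n y i = alphaF n x i) ∧ (i ≤ k → alphaF n y i = 1 - alphaF n x i) := by
  have hk' := Finset.mem_Icc.1 hk
  refine down_ind n (fun i => (k < i → alphaF n y i = alphaF n x i) ∧
    (i ≤ k → alphaF n y i = 1 - alphaF n x i)) ?_ ?_ i hi
  · intro i h
    refine ⟨fun _ => ?_, fun _ => by omega⟩
    rw [alpha_top n x i h, alpha_top n y i h]
  · intro i h1 h2 ih
    have hm := Finset.mem_Icc.2 ⟨h1, h2⟩
    refine ⟨fun h => ?_, fun h => ?_⟩
    · rw [alpha_step n x i h2, alpha_step n y i h2, he i hm (by omega), ih.1 (by omega)]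
    · rw [alpha_step n x i h2, alpha_step n y i h2]
      by_cases hik : i = k
      · subst hik
        rw [ih.1 (by omega)]
        have : y i = 1 - x i := by
          rcases hx i hm with h | h <;> rcases hy i hm with h' | h' <;> rw [h, h'] at hne ⊢ <;>
            first | (exact absurd rfl hne) | norm_num
        rw [this]; ring
      · rw [he i hm hik, ih.2 (by omega)]
        rcases hx i hm with h | h <;> rw [h] <;> ring

theorem F_vertex (n : ℕ) (x : ℕ → ℝ) (hx : ∀ i ∈ Finset.Icc 1 n, x i = 0 ∨ x i = 1) :
    Ffun n x = ∑ i ∈ Finset.Icc 1 n, (2 : ℝ) ^ (i - 1) * alphaF n x i := by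
  unfold Ffun
  refine Finset.sum_congr rfl fun i hi => ?_
  unfold betaF
  rcases hx i hi with h | h <;> rw [h] <;> ring

theorem low_bound (d : ℕ → ℝ) (m : ℕ) (h : ∀ i ∈ Finset.Icc 1 m, -1 ≤ d i) :
    1 - (2 : ℝ) ^ m ≤ ∑ i ∈ Finset.Icc 1 m, (2 : ℝ) ^ (i - 1) * d i := by
  induction m with
  | zero => simp
  | succ m ih =>
    rw [Finset.sum_Icc_succ_top (by omega)]
    have h1 := ih fun i hi => h i (by simp at hi ⊢; omega)
    have h2 := h (m + 1) (by simp)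
    have h3 : (0 : ℝ) < 2 ^ m := by positivity
    simp only [Nat.add_sub_cancel, pow_succ]
    nlinarith

theorem sum_pos' (d : ℕ → ℝ) (n k : ℕ) (hk : 1 ≤ k) (hkn : k ≤ n)
    (h : ∀ i, 1 ≤ i → i ≤ k → -1 ≤ d i) (hd : d k = 1) (h0 : ∀ i, k < i → d i = 0) :
    0 < ∑ i ∈ Finset.Icc 1 n, (2 : ℝ) ^ (i - 1) * d i := by
  induction n, hkn using Nat.le_induction with
  | base =>
    obtain ⟨m, rfl⟩ : ∃ m, k = m + 1 := ⟨k - 1, by omega⟩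
    rw [Finset.sum_Icc_succ_top (by omega), hd]
    have h1 := low_bound d m fun i hi => h i (by simp at hi; omega) (by simp at hi; omega)
    simp only [Nat.add_sub_cancel]
    linarith
  | succ n hn ih =>
    rw [Finset.sum_Icc_succ_top (by omega), h0 (n + 1) (by omega)]
    simpa using ih

theorem F_flip (n : ℕ) (x y : ℕ → ℝ) (hx : ∀ i ∈ Finset.Icc 1 n, x i = 0 ∨ x i = 1)
    (hy : ∀ i ∈ Finset.Icc 1 n, y i = 0 ∨ y i = 1) (k : ℕ) (hk : k ∈ Finset.Icc 1 n)
    (hne : y k ≠ x k) (he : ∀ j ∈ Finset.Icc 1 n, j ≠ k → y j = x j)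
    (ha : alphaF n x k = 1) : Ffun n x > Ffun n y := by
  have hk' := Finset.mem_Icc.1 hk
  have hf := alpha_flip n x y hx hy k hk hne he
  have := sum_pos' (fun i => alphaF n x i - alphaF n y i) n k hk'.1 hk'.2
    (fun i h1 h2 => by
      rcases alpha01 n x hx i h1 with h | h <;> rcases alpha01 n y hy i h1 with h' | h' <;>
        simp only [h, h'] <;> norm_num)
    (by simp only [(hf k hk'.1).2 le_rfl, ha]; norm_num)
    (fun i hi => by simp only [(hf i (by omega)).1 hi]; norm_num)
  rw [F_vertex n x hx, F_vertex n y hy]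
  simp only [mul_sub, Finset.sum_sub_distrib] at this
  linarith

open Classical in
/-- Suffix parities of the sink. -/
noncomputable def aS (n : ℕ) (I : Finset ℕ) (δ : ℕ → ℝ) (i : ℕ) : ℝ :=
  if h : n + 1 ≤ i then 0 else
    if i ∈ I then 1 else δ i + (1 - 2 * δ i) * aS n I δ (i + 1)
termination_by n + 1 - i
decreasing_by omega

theorem aS_top (n : ℕ) (I : Finset ℕ) (δ : ℕ → ℝ) (i : ℕ) (h : n + 1 ≤ i) : aS n I δ i = 0 := by
  rw [aS]; simp [h]

theorem aS_mem (n : ℕ) (I : Finset ℕ) (δ : ℕ → ℝ) (i : ℕ) (h : i ≤ n) (hi : i ∈ I) :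
    aS n I δ i = 1 := by
  rw [aS, dif_neg (by omega), if_pos hi]

theorem aS_not (n : ℕ) (I : Finset ℕ) (δ : ℕ → ℝ) (i : ℕ) (h : i ≤ n) (hi : i ∉ I) :
    aS n I δ i = δ i + (1 - 2 * δ i) * aS n I δ (i + 1) := by
  rw [aS, dif_neg (by omega), if_neg hi]

theorem aS01 (n : ℕ) (I : Finset ℕ) (δ : ℕ → ℝ)
    (hδ : ∀ i ∈ Finset.Icc 1 n, i ∉ I → δ i = 0 ∨ δ i = 1)
    (i : ℕ) (hi : 1 ≤ i) : aS n I δ i = 0 ∨ aS n I δ i = 1 := by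
  refine down_ind n (fun i => aS n I δ i = 0 ∨ aS n I δ i = 1) ?_ ?_ i hi
  · intro i h; left; exact aS_top n I δ i h
  · intro i h1 h2 ih
    by_cases hm : i ∈ I
    · right; exact aS_mem n I δ i h2 hm
    · rw [aS_not n I δ i h2 hm]
      rcases hδ i (Finset.mem_Icc.2 ⟨h1, h2⟩) hm with h | h <;> rcases ih with h' | h' <;>
        rw [h, h'] <;> norm_num

theorem xor_solve {a b x : ℝ} (ha : a = 0 ∨ a = 1) (hb : b = 0 ∨ b = 1)
    (h : a = x + (1 - 2 * x) * b) : x = a + (1 - 2 * a) * b := by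
  rcases ha with rfl | rfl <;> rcases hb with rfl | rfl <;> linarith

theorem stmt19 (n : ℕ) (hn : 1 ≤ n) (I : Finset ℕ) (hI : I ⊆ Finset.Icc 1 n)
    (δ : ℕ → ℝ) (hδ : ∀ i ∈ Finset.Icc 1 n, i ∉ I → δ i = 0 ∨ δ i = 1) :
    ∃ v : ℕ → ℝ, inFace n I δ v ∧
      (∀ w : ℕ → ℝ, inFace n I δ w →
        (∃ k ∈ Finset.Icc 1 n, w k ≠ v k ∧ ∀ j ∈ Finset.Icc 1 n, j ≠ k → w j = v j) →
        Ffun n v > Ffun n w) ∧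
      ∀ v' : ℕ → ℝ, inFace n I δ v' →
        (∀ w : ℕ → ℝ, inFace n I δ w →
          (∃ k ∈ Finset.Icc 1 n, w k ≠ v' k ∧ ∀ j ∈ Finset.Icc 1 n, j ≠ k → w j = v' j) →
          Ffun n v' > Ffun n w) →
        ∀ j ∈ Finset.Icc 1 n, v' j = v j := by
  have hA := aS01 n I δ hδ
  obtain ⟨v, hv⟩ : ∃ v : ℕ → ℝ, ∀ i, v i = aS n I δ i + (1 - 2 * aS n I δ i) * aS n I δ (i + 1) :=
    ⟨_, fun _ => rfl⟩
  have hv01 : ∀ i ∈ Finset.Icc 1 n, v i = 0 ∨ v i = 1 := by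
    intro i hi
    rw [hv]
    have h1 := (Finset.mem_Icc.1 hi).1
    rcases hA i h1 with h | h <;> rcases hA (i + 1) (by omega) with h' | h' <;>
      rw [h, h'] <;> norm_num
  have hva : ∀ i, 1 ≤ i → alphaF n v i = aS n I δ i := by
    refine down_ind n _ ?_ ?_
    · intro i h; rw [alpha_top n v i h, aS_top n I δ i h]
    · intro i h1 h2 ih
      rw [alpha_step n v i h2, ih]
      exact (xor_solve (hv01 i (Finset.mem_Icc.2 ⟨h1, h2⟩)) (hA (i + 1) (by omega)) (hv i)).symm
  refine ⟨v, ⟨hv01, ?_⟩, ?_, ?_⟩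
  · intro i hi hm
    have h1 := Finset.mem_Icc.1 hi
    rw [hv]
    exact (xor_solve (hA i h1.1) (hA (i + 1) (by omega)) (aS_not n I δ i h1.2 hm)).symm
  · rintro w ⟨hw, hwd⟩ ⟨k, hk, hne, he⟩
    have h1 := Finset.mem_Icc.1 hk
    have hkI : k ∈ I := by
      by_contra hm
      apply hne
      rw [hwd k hk hm, hv]
      exact xor_solve (hA k h1.1) (hA (k + 1) (by omega)) (aS_not n I δ k h1.2 hm)
    exact F_flip n v w hv01 hw k hk hne he (by rw [hva k h1.1, aS_mem n I δ k h1.2 hkI])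
  · rintro v' ⟨hv', hvd⟩ hs
    have hI1 : ∀ k ∈ I, alphaF n v' k = 1 := by
      intro k hkI
      have hk := hI hkI
      have h1 := Finset.mem_Icc.1 hk
      have hw01 : ∀ i ∈ Finset.Icc 1 n, Function.update v' k (1 - v' k) i = 0 ∨
          Function.update v' k (1 - v' k) i = 1 := by
        intro i hi
        by_cases h : i = k
        · subst h
          rcases hv' i hi with h | h <;> simp [h]
        · simpa [Function.update_of_ne h] using hv' i hi
      have hne : Function.update v' k (1 - v' k) k ≠ v' k := by
        rcases hv' k hk with h | h <;> simp [h]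
      have he : ∀ j ∈ Finset.Icc 1 n, j ≠ k → Function.update v' k (1 - v' k) j = v' j :=
        fun j _ h => Function.update_of_ne h _ _
      have hgt := hs (Function.update v' k (1 - v' k))
        ⟨hw01, fun i hi hm => by
          rw [he i hi (by rintro rfl; exact hm hkI)]; exact hvd i hi hm⟩ ⟨k, hk, hne, he⟩
      rcases alpha01 n v' hv' k h1.1 with h | h
      · exfalso
        have hf := (alpha_flip n v' _ hv' hw01 k hk hne he k h1.1).2 le_rfl
        have := F_flip n _ v' hw01 hv' k hk hne.symm (fun j hj h => (he j hj h).symm)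
          (by rw [hf, h]; norm_num)
        linarith
      · exact h
    have hva' : ∀ i, 1 ≤ i → alphaF n v' i = aS n I δ i := by
      refine down_ind n _ ?_ ?_
      · intro i h; rw [alpha_top n v' i h, aS_top n I δ i h]
      · intro i h1 h2 ih
        by_cases hm : i ∈ I
        · rw [hI1 i hm, aS_mem n I δ i h2 hm]
        · rw [alpha_step n v' i h2, ih, aS_not n I δ i h2 hm,
            hvd i (Finset.mem_Icc.2 ⟨h1, h2⟩) hm]
    intro j hj
    have h1 := Finset.mem_Icc.1 hj
    have := alpha_step n v' j h1.2
    rw [hva' j h1.1, hva' (j + 1) (by omega)] at this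
    rw [hv]
    exact xor_solve (hA j h1.1) (hA (j + 1) (by omega)) this
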